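/- arXiv:2407.09321 — 3 statements merged into one kernel-verified Lean document; each statement's English description precedes it below -/
import Mathlib

section
/- For every real μ, every real x ≠ 0, and every q > 0, the Laplace transform of h satisfies ∫₀^∞ e^{−q t} h(t; x, μ) dt = exp(−(μ + sgn(x)·√(2q + μ²))·x), where sgn(x) is the sign of x. -/
open MeasureTheory Real Set Filter

/-- The auxiliary density `h(t; x, μ) = |x| / √(2π t³) · exp(−(x + μ t)² / (2t))`. -/
noncomputable def h (t x μ : ℝ) : ℝ :=
  |x| / Real.sqrt (2 * Real.pi * t ^ 3) * Real.exp (-(x + μ * t) ^ 2 / (2 * t))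

open scoped Topology

theorem integral_Ioi_of_hasDerivAt_of_nonneg_of_tendsto {f f' : ℝ → ℝ} {a l m : ℝ}
    (hderiv : ∀ t ∈ Ioi a, HasDerivAt f (f' t) t) (hpos : ∀ t ∈ Ioi a, 0 ≤ f' t)
    (hl : Tendsto f (𝓝[>] a) (𝓝 l)) (hm : Tendsto f atTop (𝓝 m)) :
    ∫ t in Ioi a, f' t = m - l := by
  have hcont : ContinuousWithinAt (Function.update f a l) (Ici a) a := by
    rw [continuousWithinAt_update_same, Ici_sdiff_left]
    exact hl
  have hderivUpdate : ∀ t ∈ Ioi a, HasDerivAt (Function.update f a l) (f' t) t := by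
    intro t ht
    refine (hderiv t ht).congr_of_eventuallyEq ?_
    filter_upwards [Ioi_mem_nhds ht] with s hs
    exact Function.update_of_ne (ne_of_gt hs) _ _
  have hupdate : Tendsto (Function.update f a l) atTop (𝓝 m) := by
    refine hm.congr' ?_
    filter_upwards [Ioi_mem_atTop a] with s hs
    exact (Function.update_of_ne (ne_of_gt hs) _ _).symm
  simpa using integral_Ioi_of_hasDerivAt_of_nonneg hcont hderivUpdate hpos hupdate

/-- The primitive of `exp (-u ^ 2 / 2)` vanishing at `0`. -/
noncomputable def gaussianPrimitive (z : ℝ) : ℝ :=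
  ∫ u in (0 : ℝ)..z, Real.exp (-(1 / 2) * u ^ 2)

theorem hasDerivAt_gaussianPrimitive (z : ℝ) :
    HasDerivAt gaussianPrimitive (Real.exp (-(1 / 2) * z ^ 2)) z := by
  have hc : Continuous fun u : ℝ => Real.exp (-(1 / 2) * u ^ 2) := by fun_prop
  exact hc.integral_hasStrictDerivAt 0 z |>.hasDerivAt

theorem gaussianPrimitive_neg (z : ℝ) : gaussianPrimitive (-z) = -gaussianPrimitive z := by
  have key := intervalIntegral.integral_comp_neg (a := 0) (b := z)
    (fun u : ℝ => Real.exp (-(1 / 2) * u ^ 2))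
  simp only [even_two, Even.neg_pow, neg_zero] at key
  rw [gaussianPrimitive, gaussianPrimitive, key, intervalIntegral.integral_symm]

theorem tendsto_gaussianPrimitive_atTop :
    Tendsto gaussianPrimitive atTop (𝓝 (√(2 * π) / 2)) := by
  have key := intervalIntegral_tendsto_integral_Ioi 0
    (integrable_exp_neg_mul_sq (b := 1 / 2) (by norm_num)).integrableOn tendsto_id
  rw [integral_gaussian_Ioi, show π / (1 / 2) = 2 * π by ring] at key
  exact key

theorem tendsto_gaussianPrimitive_atBot :
    Tendsto gaussianPrimitive atBot (𝓝 (-(√(2 * π) / 2))) := by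
  refine (tendsto_gaussianPrimitive_atTop.comp tendsto_neg_atBot_atTop).neg.congr fun z => ?_
  simp [gaussianPrimitive_neg]

/-- The inverse Gaussian density has total mass one. -/
theorem integral_inverseGaussian {a b : ℝ} (ha : 0 < a) (hb : 0 < b) :
    ∫ t in Ioi (0 : ℝ), a / √(2 * π * t ^ 3) * Real.exp (-(a - b * t) ^ 2 / (2 * t)) = 1 := by
  have hpi : 0 < √(2 * π) := by positivity
  let F : ℝ → ℝ := fun t => (√(2 * π))⁻¹ * (gaussianPrimitive (b * √t - a / √t)
    + Real.exp (2 * a * b) * gaussianPrimitive (-(b * √t) - a / √t))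
  have hderiv : ∀ t ∈ Ioi (0 : ℝ), HasDerivAt F
      (a / √(2 * π * t ^ 3) * Real.exp (-(a - b * t) ^ 2 / (2 * t))) t := by
    intro t ht
    have ht : 0 < t := ht
    have hs : 0 < √t := Real.sqrt_pos.2 ht
    have hsq := Real.hasDerivAt_sqrt ht.ne'
    have hdiv : HasDerivAt (fun t => a / √t) (-(a * (1 / (2 * √t))) / √t ^ 2) t := by
      simpa using (hasDerivAt_const t a).fun_div hsq hs.ne'
    have hu := (hasDerivAt_gaussianPrimitive (b * √t - a / √t)).comp t
      ((hsq.const_mul b).sub hdiv)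
    have hv := (hasDerivAt_gaussianPrimitive (-(b * √t) - a / √t)).comp t
      ((hsq.const_mul b).neg.sub hdiv)
    refine ((hu.add (hv.const_mul (Real.exp (2 * a * b)))).const_mul (√(2 * π))⁻¹).congr_deriv ?_
    have h3 : √(2 * π * t ^ 3) = √(2 * π) * √t ^ 3 := by
      rw [Real.sqrt_mul (by positivity)]
      congr 1
      rw [show t ^ 3 = (√t ^ 3) ^ 2 by rw [← pow_mul, mul_comm, pow_mul, Real.sq_sqrt ht.le],
        Real.sqrt_sq (by positivity)]
    rw [h3]
    have hst : t = √t ^ 2 := (Real.sq_sqrt ht.le).symm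
    have e1 : -(a - b * t) ^ 2 / (2 * t) = -(1 / 2) * (b * √t - a / √t) ^ 2 := by
      generalize √t = s at *
      subst hst
      field_simp
      ring
    have e2 : Real.exp (2 * a * b) * Real.exp (-(1 / 2) * (-(b * √t) - a / √t) ^ 2)
        = Real.exp (-(1 / 2) * (b * √t - a / √t) ^ 2) := by
      rw [← Real.exp_add]
      congr 1
      field_simp
      ring
    rw [e1, ← mul_assoc (Real.exp (2 * a * b)), e2]
    field_simp
    ring
  have hsqrt0 : Tendsto (fun t : ℝ => √t) (𝓝[>] 0) (𝓝[>] 0) := by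
    refine tendsto_nhdsWithin_iff.2 ⟨?_, ?_⟩
    · simpa using (Real.continuous_sqrt.tendsto 0).mono_left nhdsWithin_le_nhds
    · filter_upwards [self_mem_nhdsWithin] with t ht
      exact Real.sqrt_pos.2 ht
  have hdiv0 : Tendsto (fun t : ℝ => -(a / √t)) (𝓝[>] 0) atBot := by
    simp only [div_eq_mul_inv]
    exact tendsto_neg_atTop_atBot.comp
      ((tendsto_inv_nhdsGT_zero.comp hsqrt0).const_mul_atTop ha)
  have hlin0 (c : ℝ) : Tendsto (fun t : ℝ => c * √t) (𝓝[>] 0) (𝓝 (c * 0)) :=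
    (hsqrt0.mono_right nhdsWithin_le_nhds).const_mul c
  have hdivTop : Tendsto (fun t : ℝ => -(a / √t)) atTop (𝓝 (-0)) :=
    (Real.tendsto_sqrt_atTop.const_div_atTop a).neg
  have hlinTop : Tendsto (fun t : ℝ => b * √t) atTop atTop :=
    Real.tendsto_sqrt_atTop.const_mul_atTop hb
  have hl : Tendsto F (𝓝[>] 0) (𝓝 ((√(2 * π))⁻¹ *
      (-(√(2 * π) / 2) + Real.exp (2 * a * b) * -(√(2 * π) / 2)))) := by
    refine ((tendsto_gaussianPrimitive_atBot.comp ?_).add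
      ((tendsto_gaussianPrimitive_atBot.comp ?_).const_mul _)).const_mul _
    · simpa only [sub_eq_add_neg] using (hlin0 b).add_atBot hdiv0
    · simpa only [sub_eq_add_neg, neg_mul] using (hlin0 (-b)).add_atBot hdiv0
  have hm : Tendsto F atTop (𝓝 ((√(2 * π))⁻¹ *
      (√(2 * π) / 2 + Real.exp (2 * a * b) * -(√(2 * π) / 2)))) := by
    refine ((tendsto_gaussianPrimitive_atTop.comp ?_).add
      ((tendsto_gaussianPrimitive_atBot.comp ?_).const_mul _)).const_mul _
    · simpa only [sub_eq_add_neg] using hlinTop.atTop_add hdivTop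
    · simpa only [sub_eq_add_neg, Function.comp_def] using
        (tendsto_neg_atTop_atBot.comp hlinTop).atBot_add hdivTop
  rw [integral_Ioi_of_hasDerivAt_of_nonneg_of_tendsto hderiv (fun t _ => by positivity) hl hm]
  field_simp
  ring

/-- Laplace transform of `h`:
`∫₀^∞ e^{−q t} h(t; x, μ) dt = exp(−(μ + sgn(x)·√(2q + μ²))·x)` for `x ≠ 0`, `q > 0`. -/
theorem laplace_h (μ x q : ℝ) (hx : x ≠ 0) (hq : 0 < q) :
    ∫ t in Ioi (0 : ℝ), Real.exp (-q * t) * h t x μ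
      = Real.exp (-(μ + Real.sign x * Real.sqrt (2 * q + μ ^ 2)) * x) := by
  have hb : 0 < √(2 * q + μ ^ 2) := by positivity
  have hb2 : √(2 * q + μ ^ 2) ^ 2 = 2 * q + μ ^ 2 := Real.sq_sqrt (by positivity)
  have hsign : Real.sign x * x = |x| := by
    rcases hx.lt_or_gt with hneg | hpos
    · rw [Real.sign_of_neg hneg, abs_of_neg hneg, neg_one_mul]
    · rw [Real.sign_of_pos hpos, abs_of_pos hpos, one_mul]
  generalize √(2 * q + μ ^ 2) = b at *
  have hrhs : -(μ + Real.sign x * b) * x = -μ * x - b * |x| := by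
    rw [← hsign]
    ring
  rw [hrhs, ← mul_one (Real.exp (-μ * x - b * |x|)),
    ← integral_inverseGaussian (abs_pos.2 hx) hb, ← integral_const_mul]
  refine setIntegral_congr_fun measurableSet_Ioi fun t ht => ?_
  have ht : 0 < t := ht
  have hexp : -q * t + -(x + μ * t) ^ 2 / (2 * t)
      = -μ * x - b * |x| + -(|x| - b * t) ^ 2 / (2 * t) := by
    have habs : |x| ^ 2 = x ^ 2 := sq_abs x
    field_simp
    linear_combination t ^ 2 * hb2 + habs
  simp only [h]
  rw [mul_left_comm, ← Real.exp_add, hexp, Real.exp_add, mul_left_comm]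
end

section
/- For every real μ, all x₁ > 0, x₂ > 0, and every t > 0, the convolution identity ∫₀^t h(t − τ; x₁, μ) · h(τ; x₂, μ) dτ = h(t; x₁ + x₂, μ) holds. -/
open MeasureTheory Real Set Filter

open scoped Topology

lemma tendsto_gaussian_primitive_atTop {c : ℝ} (hc : 0 < c) :
    Tendsto (fun x : ℝ => ∫ y in (0 : ℝ)..x, exp (-c * y ^ 2)) atTop (𝓝 (√(π / c) / 2)) := by
  rw [← integral_gaussian_Ioi c]
  exact intervalIntegral_tendsto_integral_Ioi 0
    (integrable_exp_neg_mul_sq hc).integrableOn tendsto_id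

lemma tendsto_gaussian_primitive_atBot {c : ℝ} (hc : 0 < c) :
    Tendsto (fun x : ℝ => ∫ y in (0 : ℝ)..x, exp (-c * y ^ 2)) atBot
      (𝓝 (-(√(π / c) / 2))) := by
  have key := ((tendsto_gaussian_primitive_atTop hc).comp tendsto_neg_atBot_atTop).neg
  refine key.congr fun x => ?_
  have := intervalIntegral.integral_comp_neg (a := 0) (b := x) fun y : ℝ => exp (-c * y ^ 2)
  simp only [neg_sq, neg_zero] at this
  rw [Function.comp_apply, this, intervalIntegral.integral_symm (-x) 0, neg_neg]

lemma hasDerivAt_gaussian_primitive (c x : ℝ) :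
    HasDerivAt (fun x : ℝ => ∫ y in (0 : ℝ)..x, exp (-c * y ^ 2)) (exp (-c * x ^ 2)) x := by
  have hcont : Continuous fun y : ℝ => exp (-c * y ^ 2) := by fun_prop
  exact intervalIntegral.integral_hasDerivAt_right (hcont.intervalIntegrable _ _)
    hcont.aestronglyMeasurable.stronglyMeasurableAtFilter hcont.continuousAt

/-- The fundamental theorem of calculus for a nonnegative derivative on an open interval, with
one-sided limits at the end points; integrability is automatic. -/
lemma integral_eq_sub_of_hasDerivAt_of_tendsto_of_nonneg {f f' : ℝ → ℝ} {a b fa fb : ℝ}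
    (hab : a < b) (hderiv : ∀ x ∈ Ioo a b, HasDerivAt f (f' x) x)
    (hpos : ∀ x ∈ Ioo a b, 0 ≤ f' x) (ha : Tendsto f (𝓝[>] a) (𝓝 fa))
    (hb : Tendsto f (𝓝[<] b) (𝓝 fb)) : ∫ x in a..b, f' x = fb - fa := by
  have hcont : ContinuousOn f (Ioo a b) := fun x hx =>
    (hderiv x hx).continuousAt.continuousWithinAt
  have hext : ContinuousOn (extendFrom (Ioo a b) f) (Icc a b) :=
    continuousOn_Icc_extendFrom_Ioo hcont ha hb
  have hderiv' : ∀ x ∈ Ioo a b, HasDerivAt (extendFrom (Ioo a b) f) (f' x) x := by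
    intro x hx
    refine (hderiv x hx).congr_of_eventuallyEq ?_
    filter_upwards [isOpen_Ioo.mem_nhds hx] with y hy
    exact extendFrom_extends hcont y hy
  have hint := intervalIntegral.integrableOn_deriv_of_nonneg hext hderiv' hpos
  exact intervalIntegral.integral_eq_sub_of_hasDerivAt_of_tendsto hab hderiv
    ((intervalIntegrable_iff_integrableOn_Ioc_of_le hab.le).2 hint) ha hb

lemma hasDerivAt_linear_div_sqrt {t s : ℝ} (hs : s ∈ Ioo 0 t) (a b : ℝ) :
    HasDerivAt (fun s => (b * (t - s) + a * s) / √(s * (t - s)))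
      (t * (a * s - b * (t - s)) / (2 * √(s * (t - s)) ^ 3)) s := by
  have hp : 0 < s * (t - s) := mul_pos hs.1 (sub_pos.2 hs.2)
  have hr : 0 < √(s * (t - s)) := sqrt_pos.2 hp
  have hsub : HasDerivAt (fun s : ℝ => t - s) (-1) s := (hasDerivAt_id s).const_sub t
  have hprod := ((hasDerivAt_id s).mul hsub).sqrt hp.ne'
  have hnum := (hsub.const_mul b).add ((hasDerivAt_id s).const_mul a)
  refine (hnum.div hprod hr.ne').congr_deriv ?_
  have hsq : √(s * (t - s)) ^ 2 = s * (t - s) := sq_sqrt hp.le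
  simp only [id, Pi.mul_apply, Pi.add_apply]
  generalize √(s * (t - s)) = r at hr hsq
  field_simp
  rw [hsq]
  ring

lemma tendsto_linear_div_sqrt_nhdsGT_zero {t b : ℝ} (ht : 0 < t) (hb : 0 < b) (a : ℝ) :
    Tendsto (fun s => (b * (t - s) + a * s) / √(s * (t - s))) (𝓝[>] 0) atTop := by
  have hnum : Tendsto (fun s => b * (t - s) + a * s) (𝓝[>] 0) (𝓝 (b * t)) := by
    have : Continuous fun s => b * (t - s) + a * s := by fun_prop
    simpa using (this.tendsto 0).mono_left nhdsWithin_le_nhds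
  have hden : Tendsto (fun s => √(s * (t - s))) (𝓝[>] 0) (𝓝[>] 0) := by
    refine tendsto_nhdsWithin_iff.2 ⟨?_, ?_⟩
    · have : Continuous fun s => √(s * (t - s)) := by fun_prop
      simpa using (this.tendsto 0).mono_left nhdsWithin_le_nhds
    · filter_upwards [Ioo_mem_nhdsGT ht] with s hs
      exact sqrt_pos.2 (mul_pos hs.1 (sub_pos.2 hs.2))
  simpa only [div_eq_mul_inv, Function.comp_def] using
    hnum.pos_mul_atTop (mul_pos hb ht) (tendsto_inv_nhdsGT_zero.comp hden)

lemma tendsto_linear_div_sqrt_nhdsLT {t a : ℝ} (ht : 0 < t) (ha : 0 < a) (b : ℝ) :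
    Tendsto (fun s => (b * (t - s) + a * s) / √(s * (t - s))) (𝓝[<] t) atTop := by
  have hrefl : Tendsto (fun s => t - s) (𝓝[<] t) (𝓝[>] 0) := by
    refine tendsto_nhdsWithin_iff.2 ⟨?_, ?_⟩
    · have : Continuous fun s => t - s := by fun_prop
      simpa using (this.tendsto t).mono_left nhdsWithin_le_nhds
    · filter_upwards [self_mem_nhdsWithin] with s hs
      exact sub_pos.2 (mem_Iio.1 hs)
  refine ((tendsto_linear_div_sqrt_nhdsGT_zero ht ha b).comp hrefl).congr fun s => ?_
  simp only [Function.comp_apply, sub_sub_cancel]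
  rw [add_comm, mul_comm s]

lemma integral_exp_neg_sq_div_sqrt_pow_three {a b t : ℝ} (ha : 0 < a) (hb : 0 < b) (ht : 0 < t) :
    ∫ s in (0 : ℝ)..t, exp (-(2 * t)⁻¹ * ((b * (t - s) + -a * s) / √(s * (t - s))) ^ 2) /
      √(s * (t - s)) ^ 3 = √(2 * π * t) * (a + b) / (a * b * t ^ 2) := by
  have hc : 0 < (2 * t)⁻¹ := by positivity
  have htop := tendsto_gaussian_primitive_atTop hc
  have hbot := tendsto_gaussian_primitive_atBot hc
  have hval : π / (2 * t)⁻¹ = 2 * π * t := by field_simp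
  rw [hval] at htop hbot
  have hminus : Tendsto (fun s => (b * (t - s) + -a * s) / √(s * (t - s))) (𝓝[<] t) atBot := by
    refine (tendsto_neg_atTop_atBot.comp (tendsto_linear_div_sqrt_nhdsLT ht ha (-b))).congr ?_
    intro s
    simp only [Function.comp_apply]
    ring
  set α : ℝ := -((a + b) / (a * b * t ^ 2)) with hα
  set β : ℝ := (b - a) / (a * b * t ^ 2) * exp (2 * a * b / t) with hβ
  have hlim0 := ((htop.comp (tendsto_linear_div_sqrt_nhdsGT_zero ht hb (-a))).const_mul α).add
    ((htop.comp (tendsto_linear_div_sqrt_nhdsGT_zero ht hb a)).const_mul β)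
  have hlimt := ((hbot.comp hminus).const_mul α).add
    ((htop.comp (tendsto_linear_div_sqrt_nhdsLT ht ha b)).const_mul β)
  rw [integral_eq_sub_of_hasDerivAt_of_tendsto_of_nonneg ht ?_ ?_ hlim0 hlimt]
  · rw [hα]; ring
  · intro s hs
    have hp : 0 < s * (t - s) := mul_pos hs.1 (sub_pos.2 hs.2)
    have hr : 0 < √(s * (t - s)) := sqrt_pos.2 hp
    have hsq : √(s * (t - s)) ^ 2 = s * (t - s) := sq_sqrt hp.le
    have hd := (((hasDerivAt_gaussian_primitive (2 * t)⁻¹ _).comp s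
      (hasDerivAt_linear_div_sqrt hs (-a) b)).const_mul α).add
      (((hasDerivAt_gaussian_primitive (2 * t)⁻¹ _).comp s
      (hasDerivAt_linear_div_sqrt hs a b)).const_mul β)
    refine hd.congr_deriv ?_
    have hexp : exp (-(2 * t)⁻¹ * ((b * (t - s) + -a * s) / √(s * (t - s))) ^ 2) =
        exp (2 * a * b / t) *
          exp (-(2 * t)⁻¹ * ((b * (t - s) + a * s) / √(s * (t - s))) ^ 2) := by
      rw [← exp_add]
      congr 1
      rw [div_pow, div_pow, hsq]
      have h1 := hs.1.ne'
      have h2 := (sub_pos.2 hs.2).ne'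
      field_simp
      ring
    rw [hexp, hα, hβ]
    field_simp
    ring
  · intro s hs
    positivity

lemma h_mul_h_eq {x₁ x₂ t τ : ℝ} (μ : ℝ) (hx₁ : 0 < x₁) (hx₂ : 0 < x₂) (hτ : τ ∈ Ioo 0 t) :
    h (t - τ) x₁ μ * h τ x₂ μ =
      x₁ * x₂ / (2 * π) * exp (-(x₁ + x₂ + μ * t) ^ 2 / (2 * t)) *
        (exp (-(2 * t)⁻¹ * ((x₂ * (t - τ) + -x₁ * τ) / √(τ * (t - τ))) ^ 2) /
          √(τ * (t - τ)) ^ 3) := by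
  have h0 : 0 < τ := hτ.1
  have h1 : 0 < t - τ := sub_pos.2 hτ.2
  have ht : 0 < t := h0.trans hτ.2
  have hp : 0 < τ * (t - τ) := mul_pos h0 h1
  have hsq : √(τ * (t - τ)) ^ 2 = τ * (t - τ) := sq_sqrt hp.le
  have hden : √(2 * π * (t - τ) ^ 3) * √(2 * π * τ ^ 3) = 2 * π * √(τ * (t - τ)) ^ 3 := by
    rw [← sqrt_mul (by positivity), sqrt_eq_iff_mul_self_eq (by positivity) (by positivity)]
    linear_combination (-4 * π ^ 2 * ((√(τ * (t - τ)) ^ 2) ^ 2 +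
      √(τ * (t - τ)) ^ 2 * (τ * (t - τ)) + (τ * (t - τ)) ^ 2)) * hsq
  have hexp : exp (-(x₁ + μ * (t - τ)) ^ 2 / (2 * (t - τ))) * exp (-(x₂ + μ * τ) ^ 2 / (2 * τ)) =
      exp (-(x₁ + x₂ + μ * t) ^ 2 / (2 * t)) *
        exp (-(2 * t)⁻¹ * ((x₂ * (t - τ) + -x₁ * τ) / √(τ * (t - τ))) ^ 2) := by
    rw [← exp_add, ← exp_add]
    congr 1
    rw [div_pow, hsq]
    field_simp
    ring
  rw [h, h, abs_of_pos hx₁, abs_of_pos hx₂, mul_mul_mul_comm, hexp, div_mul_div_comm, hden]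
  field_simp

/-- Convolution identity: for `μ ∈ ℝ`, `x₁, x₂ > 0` and `t > 0`,
`∫₀^t h(t − τ; x₁, μ) h(τ; x₂, μ) dτ = h(t; x₁ + x₂, μ)`. -/
theorem h_convolution (μ x₁ x₂ t : ℝ) (hx₁ : 0 < x₁) (hx₂ : 0 < x₂) (ht : 0 < t) :
    ∫ τ in (0 : ℝ)..t, h (t - τ) x₁ μ * h τ x₂ μ = h t (x₁ + x₂) μ := by
  rw [intervalIntegral.integral_congr_Ioo_of_le ht.le fun τ hτ => h_mul_h_eq μ hx₁ hx₂ hτ,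
    intervalIntegral.integral_const_mul, integral_exp_neg_sq_div_sqrt_pow_three hx₁ hx₂ ht, h,
    abs_of_pos (add_pos hx₁ hx₂)]
  have hsqrt : √(2 * π * t ^ 3) = t * √(2 * π * t) := by
    rw [show 2 * π * t ^ 3 = t ^ 2 * (2 * π * t) by ring, sqrt_mul (sq_nonneg t),
      sqrt_sq ht.le]
  have hpos : 0 < √(2 * π * t) := sqrt_pos.2 (by positivity)
  have hsq : √(2 * π * t) ^ 2 = 2 * π * t := sq_sqrt (by positivity)
  rw [hsqrt]
  generalize √(2 * π * t) = r at hpos hsq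
  field_simp
  rw [hsq]
end

section
/- Let β ∈ (−1, 1), μ ∈ ℝ, t > 0 and y > 0. Then 2(1+β) e^{2 μ y} ∫₀^∞ ∫₀^t h(t − τ; (1+β) b + y, μ) · h(τ; (1−β) b, −μ) dτ db = ((1+β)/√(2π t)) · e^{−(y − μ t)²/(2 t)} · [ 1 − (β μ / 2) √(2π t) · e^{(y + β μ t)²/(2 t)} · erfc( (y + β μ t)/√(2 t) ) ]. -/
open MeasureTheory Real Set Filter

/-- The complementary error function `erfc(z) = (2/√π) ∫_z^∞ e^{−u²} du`. -/
noncomputable def erfc (z : ℝ) : ℝ :=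
  2 / Real.sqrt Real.pi * ∫ u in Ioi z, Real.exp (-u ^ 2)

open scoped Topology

lemma h_eq_h_zero_mul_exp {s : ℝ} (hs : 0 < s) (x μ : ℝ) :
    h s x μ = h s x 0 * Real.exp (-x * μ - μ ^ 2 * s / 2) := by
  unfold h
  rw [mul_assoc (|x| / _), ← Real.exp_add]
  congr 2
  field_simp
  ring

lemma sqrt_two_pi_mul_cube {s : ℝ} (hs : 0 < s) :
    Real.sqrt (2 * Real.pi * s ^ 3) = Real.sqrt (2 * Real.pi) * Real.sqrt s ^ 3 := by
  rw [Real.sqrt_mul (by positivity)]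
  congr 1
  rw [Real.sqrt_eq_iff_mul_self_eq (by positivity) (by positivity)]
  have := Real.sq_sqrt hs.le
  calc s ^ 3 = (√s ^ 2) ^ 3 := by rw [this]
    _ = _ := by ring

lemma h_zero_mul_h_zero {t τ a c : ℝ} (hτ : 0 < τ) (hτt : τ < t) (ha : 0 < a) (hc : 0 < c) :
    h (t - τ) a 0 * h τ c 0 = a * c / (2 * Real.pi * Real.sqrt (τ * (t - τ)) ^ 3) *
      Real.exp (-(a ^ 2 / (2 * (t - τ)) + c ^ 2 / (2 * τ))) := by
  have hs : 0 < t - τ := sub_pos.2 hτt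
  have hexp : Real.exp (-(a ^ 2 / (2 * (t - τ)) + c ^ 2 / (2 * τ))) =
      Real.exp (-(a + 0 * (t - τ)) ^ 2 / (2 * (t - τ))) *
        Real.exp (-(c + 0 * τ) ^ 2 / (2 * τ)) := by
    rw [← Real.exp_add]
    congr 1
    ring
  have hpi : Real.sqrt (2 * Real.pi) ^ 2 = 2 * Real.pi := Real.sq_sqrt (by positivity)
  unfold h
  rw [hexp, sqrt_two_pi_mul_cube hs, sqrt_two_pi_mul_cube hτ, Real.sqrt_mul hτ.le,
    abs_of_pos ha, abs_of_pos hc]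
  have h1 := Real.sqrt_pos.2 hs
  have h2 := Real.sqrt_pos.2 hτ
  have h3 : 0 < Real.sqrt (2 * Real.pi) := by positivity
  generalize Real.sqrt (2 * Real.pi) = r at *
  rw [← hpi]
  field_simp

lemma exists_h_zero_le {x : ℝ} (hx : 0 < x) : ∃ C, ∀ s, 0 < s → h s x 0 ≤ C := by
  refine ⟨x * (1 + 24 / (Real.pi * x ^ 6)), fun s hs => ?_⟩
  set k := x ^ 2 / (2 * s) with hk
  have hk0 : 0 < k := by positivity
  have h1 : Real.exp (-(x + 0 * s) ^ 2 / (2 * s)) = (Real.exp k)⁻¹ := by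
    rw [← Real.exp_neg]
    congr 1
    rw [hk]
    ring
  have h2 : k ^ 3 / 6 ≤ Real.exp k := by
    simpa [Nat.factorial] using Real.pow_div_factorial_le_exp k hk0.le 3
  have h3 : 1 ≤ Real.exp k := Real.one_le_exp hk0.le
  set q := Real.sqrt (2 * Real.pi * s ^ 3) with hq
  have hq0 : 0 < q := by positivity
  have hq2 : q ^ 2 = 2 * Real.pi * s ^ 3 := Real.sq_sqrt (by positivity)
  have h4 : 1 / q ≤ 1 + 1 / q ^ 2 := by
    have : 1 / q ^ 2 = (1 / q) ^ 2 := by ring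
    rw [this]
    nlinarith [sq_nonneg (1 / q - 1 / 2)]
  have h5 : (Real.exp k)⁻¹ ≤ 1 := inv_le_one_of_one_le₀ h3
  have h6 : 1 / q ^ 2 * (Real.exp k)⁻¹ ≤ 24 / (Real.pi * x ^ 6) := by
    calc 1 / q ^ 2 * (Real.exp k)⁻¹ ≤ 1 / q ^ 2 * (k ^ 3 / 6)⁻¹ := by gcongr
      _ = 24 / (Real.pi * x ^ 6) := by
        rw [hq2, hk]
        field_simp
        norm_num
  unfold h
  rw [h1, abs_of_pos hx, ← hq]
  calc x / q * (Real.exp k)⁻¹ = x * (1 / q * (Real.exp k)⁻¹) := by ring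
    _ ≤ x * ((1 + 1 / q ^ 2) * (Real.exp k)⁻¹) := by gcongr
    _ = x * ((Real.exp k)⁻¹ + 1 / q ^ 2 * (Real.exp k)⁻¹) := by ring
    _ ≤ _ := by gcongr

lemma h_nonneg (s x μ : ℝ) : 0 ≤ h s x μ := by
  unfold h
  positivity

lemma intervalIntegrable_h_zero_mul_h_zero {t a c : ℝ} (ht : 0 < t) (ha : 0 < a) (hc : 0 < c) :
    IntervalIntegrable (fun τ => h (t - τ) a 0 * h τ c 0) volume 0 t := by
  obtain ⟨A, hA⟩ := exists_h_zero_le ha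
  obtain ⟨C, hC⟩ := exists_h_zero_le hc
  rw [intervalIntegrable_iff_integrableOn_Ioo_of_le ht.le]
  refine Measure.integrableOn_of_bounded (M := A * C) (by simp) ?_ ?_
  · unfold h
    fun_prop
  · refine (ae_restrict_iff' measurableSet_Ioo).2 (Eventually.of_forall fun τ hτ => ?_)
    rw [Real.norm_of_nonneg (mul_nonneg (h_nonneg ..) (h_nonneg ..))]
    have h1 := hA (t - τ) (sub_pos.2 hτ.2)
    exact mul_le_mul h1 (hC τ hτ.1) (h_nonneg ..) ((h_nonneg ..).trans h1)

lemma hasDerivAt_div_sqrt_mul_sub {t τ : ℝ} (hτ : 0 < τ) (hτt : τ < t) (a c : ℝ) :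
    HasDerivAt (fun τ => (a * τ - c * (t - τ)) / Real.sqrt (τ * (t - τ)))
      (t * (a * τ + c * (t - τ)) / (2 * Real.sqrt (τ * (t - τ)) ^ 3)) τ := by
  have hs : 0 < t - τ := sub_pos.2 hτt
  have hp : 0 < τ * (t - τ) := mul_pos hτ hs
  have hd : HasDerivAt (fun τ : ℝ => t - τ) (-1) τ := (hasDerivAt_id τ).const_sub t
  have hnum : HasDerivAt (fun τ => a * τ - c * (t - τ)) (a * 1 - c * (-1)) τ :=
    ((hasDerivAt_id τ).const_mul a).sub (hd.const_mul c)
  have hden := ((hasDerivAt_id τ).mul hd).sqrt hp.ne'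
  refine (hnum.div hden (Real.sqrt_pos.2 hp).ne').congr_deriv ?_
  have hq : 0 < Real.sqrt (τ * (t - τ)) := Real.sqrt_pos.2 hp
  have hq2 := Real.sq_sqrt hp.le
  simp only [id, Pi.mul_apply]
  set q := Real.sqrt (τ * (t - τ))
  field_simp
  rw [hq2]
  ring

lemma tendsto_inv_sqrt_mul_sub_atTop {t τ₀ : ℝ} {l : Filter ℝ} (hl : l ≤ 𝓝 τ₀)
    (h₀ : τ₀ * (t - τ₀) = 0) (hpos : ∀ᶠ τ in l, 0 < τ * (t - τ)) :
    Tendsto (fun τ => (Real.sqrt (τ * (t - τ)))⁻¹) l atTop := by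
  refine Tendsto.inv_tendsto_nhdsGT_zero (tendsto_nhdsWithin_iff.2 ⟨?_, ?_⟩)
  · have hcont : Continuous fun τ : ℝ => Real.sqrt (τ * (t - τ)) := by fun_prop
    simpa [h₀] using (hcont.tendsto τ₀).mono_left hl
  · filter_upwards [hpos] with τ hτ using Real.sqrt_pos.2 hτ

lemma tendsto_integral_gaussian_atTop {b : ℝ} (hb : 0 < b) :
    Tendsto (fun x => ∫ u in (0 : ℝ)..x, Real.exp (-b * u ^ 2)) atTop
      (𝓝 (Real.sqrt (Real.pi / b) / 2)) := by
  rw [← integral_gaussian_Ioi]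
  exact intervalIntegral_tendsto_integral_Ioi 0 (integrable_exp_neg_mul_sq hb).integrableOn
    tendsto_id

lemma tendsto_integral_gaussian_atBot {b : ℝ} (hb : 0 < b) :
    Tendsto (fun x => ∫ u in (0 : ℝ)..x, Real.exp (-b * u ^ 2)) atBot
      (𝓝 (-(Real.sqrt (Real.pi / b) / 2))) := by
  refine (((tendsto_integral_gaussian_atTop hb).comp tendsto_neg_atBot_atTop).neg).congr fun x => ?_
  have := intervalIntegral.integral_comp_neg (a := 0) (b := x) fun u : ℝ => Real.exp (-b * u ^ 2)
  simp only [neg_sq, neg_zero] at this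
  rw [Function.comp_apply, this, intervalIntegral.integral_symm, neg_neg]

lemma hasDerivAt_integral_gaussian (b x : ℝ) :
    HasDerivAt (fun x => ∫ u in (0 : ℝ)..x, Real.exp (-b * u ^ 2)) (Real.exp (-b * x ^ 2)) x := by
  have hcont : Continuous fun u : ℝ => Real.exp (-b * u ^ 2) := by fun_prop
  exact intervalIntegral.integral_hasDerivAt_right (hcont.intervalIntegrable _ _)
    hcont.stronglyMeasurable.stronglyMeasurableAtFilter hcont.continuousAt

lemma exp_mul_exp_neg_div_sqrt_sq {t τ : ℝ} (hτ : 0 < τ) (hτt : τ < t) (a c : ℝ) :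
    Real.exp (-(a + c) ^ 2 / (2 * t)) * Real.exp (-(1 / (2 * t)) *
        ((a * τ - c * (t - τ)) / Real.sqrt (τ * (t - τ))) ^ 2) =
      Real.exp (-(a ^ 2 / (2 * (t - τ)) + c ^ 2 / (2 * τ))) := by
  have hs : 0 < t - τ := sub_pos.2 hτt
  have ht : 0 < t := hτ.trans hτt
  rw [← Real.exp_add, div_pow, Real.sq_sqrt (mul_pos hτ hs).le]
  congr 1
  field_simp
  ring

/-- The driftless densities `h(·; x, 0)` form a convolution semigroup in `x > 0`. -/
theorem integral_h_zero_mul_h_zero {t a c : ℝ} (ht : 0 < t) (ha : 0 < a) (hc : 0 < c) :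
    ∫ τ in (0 : ℝ)..t, h (t - τ) a 0 * h τ c 0 = h t (a + c) 0 := by
  have hb : 0 < 1 / (2 * t) := by positivity
  set G : ℝ → ℝ := fun x => ∫ u in (0 : ℝ)..x, Real.exp (-(1 / (2 * t)) * u ^ 2)
  set g := Real.sqrt (Real.pi / (1 / (2 * t))) / 2 with hg
  set w : ℝ → ℝ → ℝ := fun c τ => (a * τ - c * (t - τ)) / Real.sqrt (τ * (t - τ))
  set E : ℝ → ℝ := fun c => Real.exp (-(a + c) ^ 2 / (2 * t)) with hE
  set F : ℝ → ℝ := fun τ => a * c / (Real.pi * t ^ 2) *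
    ((1 / a + 1 / c) / 2 * (E c * G (w c τ)) +
      (1 / a - 1 / c) / 2 * (E (-c) * G (w (-c) τ)))
  have hpos : ∀ τ ∈ Ioo 0 t, 0 < τ * (t - τ) := fun τ hτ => mul_pos hτ.1 (sub_pos.2 hτ.2)
  have hderivG : ∀ d, ∀ τ ∈ Ioo 0 t, HasDerivAt (fun τ => E d * G (w d τ))
      (Real.exp (-(a ^ 2 / (2 * (t - τ)) + d ^ 2 / (2 * τ))) *
        (t * (a * τ + d * (t - τ)) / (2 * Real.sqrt (τ * (t - τ)) ^ 3))) τ := by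
    intro d τ hτ
    have := ((hasDerivAt_integral_gaussian (1 / (2 * t)) (w d τ)).comp τ
      (hasDerivAt_div_sqrt_mul_sub hτ.1 hτ.2 a d)).const_mul (E d)
    rw [← mul_assoc, exp_mul_exp_neg_div_sqrt_sq hτ.1 hτ.2] at this
    exact this
  have hderiv : ∀ τ ∈ Ioo 0 t, HasDerivAt F (h (t - τ) a 0 * h τ c 0) τ := by
    intro τ hτ
    refine ((((hderivG c τ hτ).const_mul ((1 / a + 1 / c) / 2)).add
      ((hderivG (-c) τ hτ).const_mul ((1 / a - 1 / c) / 2))).const_mul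
        (a * c / (Real.pi * t ^ 2))).congr_deriv ?_
    rw [h_zero_mul_h_zero hτ.1 hτ.2 ha hc, neg_sq]
    have hq := Real.sqrt_pos.2 (hpos τ hτ)
    generalize Real.exp _ = e
    field_simp
    ring
  have htop : ∀ {l : Filter ℝ} {τ₀ : ℝ} (d : ℝ), l ≤ 𝓝 τ₀ → τ₀ * (t - τ₀) = 0 →
      (∀ᶠ τ in l, τ ∈ Ioo 0 t) → 0 < a * τ₀ - d * (t - τ₀) →
      Tendsto (fun τ => G (w d τ)) l (𝓝 g) := by
    intro l τ₀ d hl h₀ hev hd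
    have hcont : Continuous fun τ : ℝ => a * τ - d * (t - τ) := by fun_prop
    exact (tendsto_integral_gaussian_atTop hb).comp
      (((hcont.tendsto τ₀).mono_left hl).pos_mul_atTop hd
        (tendsto_inv_sqrt_mul_sub_atTop hl h₀ (hev.mono hpos)))
  have hbot : Tendsto (fun τ => G (w c τ)) (𝓝[>] 0) (𝓝 (-g)) := by
    have hcont : Continuous fun τ : ℝ => a * τ - c * (t - τ) := by fun_prop
    refine (tendsto_integral_gaussian_atBot hb).comp
      (((hcont.tendsto 0).mono_left nhdsWithin_le_nhds).neg_mul_atTop ?_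
        (tendsto_inv_sqrt_mul_sub_atTop nhdsWithin_le_nhds (by simp)
          (Eventually.mono (Ioo_mem_nhdsGT ht) hpos)))
    nlinarith
  have h0 : Tendsto F (𝓝[>] 0) (𝓝 (a * c / (Real.pi * t ^ 2) *
      ((1 / a + 1 / c) / 2 * (E c * -g) + (1 / a - 1 / c) / 2 * (E (-c) * g)))) := by
    have := htop (l := 𝓝[>] 0) (-c) nhdsWithin_le_nhds (by simp) (Ioo_mem_nhdsGT ht)
      (by nlinarith)
    exact (((hbot.const_mul _).const_mul _).add ((this.const_mul _).const_mul _)).const_mul _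
  have h1 : Tendsto F (𝓝[<] t) (𝓝 (a * c / (Real.pi * t ^ 2) *
      ((1 / a + 1 / c) / 2 * (E c * g) + (1 / a - 1 / c) / 2 * (E (-c) * g)))) := by
    have := fun d => htop (l := 𝓝[<] t) d nhdsWithin_le_nhds (by simp) (Ioo_mem_nhdsLT ht)
      (by nlinarith)
    exact ((((this c).const_mul _).const_mul _).add
      (((this (-c)).const_mul _).const_mul _)).const_mul _
  rw [intervalIntegral.integral_eq_sub_of_hasDerivAt_of_tendsto ht hderiv
    (intervalIntegrable_h_zero_mul_h_zero ht ha hc) h0 h1]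
  have hg' : g = Real.sqrt (2 * Real.pi) * Real.sqrt t / 2 := by
    rw [hg, ← Real.sqrt_mul (by positivity)]
    congr 2
    field_simp
  have hpi : Real.sqrt (2 * Real.pi) ^ 2 = 2 * Real.pi := Real.sq_sqrt (by positivity)
  have hst : Real.sqrt t ^ 2 = t := Real.sq_sqrt ht.le
  have hE' : Real.exp (-(a + c + 0 * t) ^ 2 / (2 * t)) = E c := by simp [hE]
  unfold h
  rw [hE', sqrt_two_pi_mul_cube ht, abs_of_pos (add_pos ha hc), hg']
  have h3 : 0 < Real.sqrt (2 * Real.pi) := by positivity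
  have h4 : 0 < Real.sqrt t := by positivity
  generalize E c = e
  generalize Real.sqrt (2 * Real.pi) = r at *
  generalize Real.sqrt t = s at *
  rw [show Real.pi = r ^ 2 / 2 by linarith, ← hst]
  field_simp
  ring

lemma integral_Ioi_comp_mul_add (f : ℝ → ℝ) {k : ℝ} (hk : 0 < k) (q : ℝ) :
    ∫ b in Ioi (0 : ℝ), f (k * b + q) = k⁻¹ * ∫ u in Ioi q, f u := by
  have h1 := integral_comp_mul_left_Ioi (fun x => f (x + q)) 0 hk
  have h2 := (measurePreserving_add_right volume q).setIntegral_preimage_emb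
    (measurableEmbedding_addRight q) f (Ioi q)
  simp only [preimage_add_const_Ioi, sub_self] at h2
  rw [mul_zero, h2] at h1
  exact h1

lemma integral_Ioi_mul_exp_neg_sq (q : ℝ) :
    ∫ u in Ioi q, u * Real.exp (-u ^ 2) = Real.exp (-q ^ 2) / 2 := by
  have hint : Integrable fun u : ℝ => u * Real.exp (-u ^ 2) := by
    simpa using integrable_mul_exp_neg_mul_sq one_pos
  have hderiv : ∀ x ∈ Ici q, HasDerivAt (fun u : ℝ => -(Real.exp (-u ^ 2) / 2))
      (x * Real.exp (-x ^ 2)) x := by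
    intro x _
    refine ((((hasDerivAt_pow 2 x).neg).exp.div_const 2).neg).congr_deriv ?_
    simp
    ring
  have hlim : Tendsto (fun u : ℝ => -(Real.exp (-u ^ 2) / 2)) atTop (𝓝 (-(0 / 2))) :=
    ((Real.tendsto_exp_neg_atTop_nhds_zero.comp
      (tendsto_pow_atTop two_ne_zero)).div_const 2).neg
  rw [integral_Ioi_of_hasDerivAt_of_tendsto' hderiv hint.integrableOn hlim]
  ring

lemma integral_Ioi_linear_mul_exp_neg_sq (m n q : ℝ) :
    ∫ u in Ioi q, (m * u - n) * Real.exp (-u ^ 2) =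
      m * (Real.exp (-q ^ 2) / 2) - n * (Real.sqrt Real.pi / 2 * erfc q) := by
  have h1 : Integrable fun u : ℝ => u * Real.exp (-u ^ 2) := by
    simpa using integrable_mul_exp_neg_mul_sq one_pos
  have h2 : Integrable fun u : ℝ => Real.exp (-u ^ 2) := by
    simpa using integrable_exp_neg_mul_sq one_pos
  have hpi : 0 < Real.sqrt Real.pi := by positivity
  simp only [sub_mul, mul_assoc]
  rw [integral_sub (h1.const_mul m).integrableOn (h2.const_mul n).integrableOn,
    integral_const_mul, integral_const_mul, integral_Ioi_mul_exp_neg_sq]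
  unfold erfc
  field_simp

/-- Transition density of skew Brownian motion with one constant drift `μ` (skew level 0,
start at 0), for `y > 0`. -/
theorem sbm_one_drift_density_pos (β μ t y : ℝ)
    (hβ : β ∈ Ioo (-1 : ℝ) 1) (ht : 0 < t) (hy : 0 < y) :
    2 * (1 + β) * Real.exp (2 * μ * y) *
        ∫ b in Ioi (0 : ℝ), ∫ τ in (0 : ℝ)..t,
          h (t - τ) ((1 + β) * b + y) μ * h τ ((1 - β) * b) (-μ)
      = (1 + β) / Real.sqrt (2 * Real.pi * t) * Real.exp (-(y - μ * t) ^ 2 / (2 * t)) *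
          (1 - β * μ / 2 * Real.sqrt (2 * Real.pi * t) *
            Real.exp ((y + β * μ * t) ^ 2 / (2 * t)) *
              erfc ((y + β * μ * t) / Real.sqrt (2 * t))) := by
  obtain ⟨hβ1, hβ2⟩ := hβ
  have hinner : ∀ b ∈ Ioi (0 : ℝ), (∫ τ in (0 : ℝ)..t,
      h (t - τ) ((1 + β) * b + y) μ * h τ ((1 - β) * b) (-μ)) =
      Real.exp (-(2 * β * b + y) * μ - μ ^ 2 * t / 2) * h t (2 * b + y) 0 := by
    intro b hb
    have hb : 0 < b := hb
    have ha : 0 < (1 + β) * b + y := add_pos (mul_pos (by linarith) hb) hy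
    have hc : 0 < (1 - β) * b := mul_pos (by linarith) hb
    rw [show 2 * b + y = (1 + β) * b + y + (1 - β) * b by ring,
      ← integral_h_zero_mul_h_zero ht ha hc, ← intervalIntegral.integral_const_mul]
    refine intervalIntegral.integral_congr_Ioo_of_le ht.le fun τ hτ => ?_
    rw [h_eq_h_zero_mul_exp (sub_pos.2 hτ.2), h_eq_h_zero_mul_exp hτ.1, mul_mul_mul_comm,
      ← Real.exp_add, mul_comm]
    congr 2
    ring
  rw [setIntegral_congr_fun measurableSet_Ioi hinner]
  set r := Real.sqrt (2 * t) with hr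
  have hr0 : 0 < r := by positivity
  have hr2 : r ^ 2 = 2 * t := Real.sq_sqrt (by positivity)
  set q := (y + β * μ * t) / r with hq
  have hqr : q * r = y + β * μ * t := div_mul_cancel₀ _ hr0.ne'
  have hq2 : (y + β * μ * t) ^ 2 / (2 * t) = q ^ 2 := by rw [hq, div_pow, hr2]
  have hN : Real.sqrt (2 * Real.pi * t ^ 3) = Real.sqrt Real.pi * r * t := by
    rw [hr, ← Real.sqrt_mul Real.pi_pos.le, show 2 * Real.pi * t ^ 3 = Real.pi * (2 * t) * t ^ 2 by
      ring, Real.sqrt_mul (by positivity), Real.sqrt_sq ht.le]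
  have hM : Real.sqrt (2 * Real.pi * t) = Real.sqrt Real.pi * r := by
    rw [hr, ← Real.sqrt_mul Real.pi_pos.le]
    congr 1
    ring
  have hpi : 0 < Real.sqrt Real.pi := by positivity
  have houter : ∀ b ∈ Ioi (0 : ℝ),
      Real.exp (-(2 * β * b + y) * μ - μ ^ 2 * t / 2) * h t (2 * b + y) 0 =
      Real.exp (q ^ 2 - y ^ 2 / (2 * t) - y * μ - μ ^ 2 * t / 2) / (Real.sqrt Real.pi * r * t) *
        ((fun u => (r * u - β * μ * t) * Real.exp (-u ^ 2)) (2 / r * b + q)) := by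
    intro b hb
    have hb : 0 < b := hb
    have hlin : r * (2 / r * b + q) - β * μ * t = 2 * b + y := by
      field_simp
      linarith
    have hexp : Real.exp (-(2 * β * b + y) * μ - μ ^ 2 * t / 2) *
        Real.exp (-(2 * b + y + 0 * t) ^ 2 / (2 * t)) =
        Real.exp (q ^ 2 - y ^ 2 / (2 * t) - y * μ - μ ^ 2 * t / 2) *
          Real.exp (-(2 / r * b + q) ^ 2) := by
      rw [← Real.exp_add, ← Real.exp_add]
      congr 1
      have hsq : (2 / r * b + q) ^ 2 = q ^ 2 + (4 * b ^ 2 + 4 * b * (y + β * μ * t)) / (2 * t) := by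
        rw [← hr2, ← hqr]
        field_simp
        ring
      rw [hsq]
      field_simp
      ring
    simp only [hlin]
    unfold h
    rw [abs_of_pos (by positivity), hN]
    linear_combination (2 * b + y) / (Real.sqrt Real.pi * r * t) * hexp
  rw [setIntegral_congr_fun measurableSet_Ioi houter, integral_const_mul,
    integral_Ioi_comp_mul_add
      (fun u => (r * u - β * μ * t) * Real.exp (-u ^ 2)) (k := 2 / r) (by positivity),
    integral_Ioi_linear_mul_exp_neg_sq, hM, hq2]
  have he1 : Real.exp (q ^ 2 - y ^ 2 / (2 * t) - y * μ - μ ^ 2 * t / 2) =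
      Real.exp (q ^ 2) * Real.exp (-(y - μ * t) ^ 2 / (2 * t)) / Real.exp (2 * μ * y) := by
    rw [← Real.exp_add, ← Real.exp_sub]
    congr 1
    field_simp
    ring
  rw [he1, Real.exp_neg]
  have ht' : t = r ^ 2 / 2 := by linarith
  generalize Real.exp (-(y - μ * t) ^ 2 / (2 * t)) = e
  rw [ht']
  have := Real.exp_pos (q ^ 2)
  have := Real.exp_pos (2 * μ * y)
  field_simp
end
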